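/- Suppose q belongs to V but not to the closure of U, let (α_i) be the quasi-greedy expansion of 1 in base q, and let k be the least positive integer such that α₁ − α_{k+i} = α_i for all i ≥ 1 (such k exists since q ∈ V ∖ closure(U), and then (α_i) is periodic with period 2k, equal to the periodic repetition of the block α₁ … α_k (α₁−α₁) … (α₁−α_k)). Then the set of all expansions of 1 in base q consists exactly of the following sequences: the sequence (α_i) itself; for each integer N ≥ 0, the sequence consisting of N copies of the block α₁ … α_{2k}, followed by the block α₁ … α_{2k−1} (α_{2k} + 1), followed by zeros; and for each integer N ≥ 0, the sequence consisting of N copies of the block α₁ … α_{2k}, followed by the block α₁ … α_{k−1} (α_k − 1), followed by the constant sequence with value α₁. -/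

import Mathlib

open Classical

noncomputable section

/-- The largest digit in base `q`: `α₁ = ⌈q⌉ - 1`. -/
def alphaOne (q : ℝ) : ℕ := (⌈q⌉ - 1).toNat

/-- `c` (0-indexed: `c i` is the digit `c_{i+1}` of the paper) is an expansion of `x`
in base `q`: all digits lie in `{0, …, α₁}` and `x = ∑_{i≥1} c_i q^{-i}`. -/
def IsExpansionOf (q x : ℝ) (c : ℕ → ℕ) : Prop :=
  (∀ i, c i ≤ alphaOne q) ∧ x = ∑' i, (c i : ℝ) / q ^ (i + 1)

/-- A sequence is called infinite if it has infinitely many nonzero terms. -/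
def InfiniteSeq (c : ℕ → ℕ) : Prop := {i | c i ≠ 0}.Infinite

/-- Strict lexicographic order on sequences. -/
def LexLt (a b : ℕ → ℕ) : Prop := ∃ n, (∀ i, i < n → a i = b i) ∧ a n < b n

/-- Lexicographic order `≤` on sequences. -/
def LexLe (a b : ℕ → ℕ) : Prop := LexLt a b ∨ a = b

/-- `b` is the greedy (lexicographically largest) expansion of `x` in base `q`. -/
def IsGreedyOf (q x : ℝ) (b : ℕ → ℕ) : Prop :=
  IsExpansionOf q x b ∧ ∀ c, IsExpansionOf q x c → LexLe c b

/-- `a` is the quasi-greedy (lexicographically largest infinite) expansion of `x`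
in base `q`. -/
def IsQuasiGreedyOf (q x : ℝ) (a : ℕ → ℕ) : Prop :=
  IsExpansionOf q x a ∧ InfiniteSeq a ∧
    ∀ c, IsExpansionOf q x c → InfiniteSeq c → LexLe c a

/-- The quasi-greedy expansion of `x` in base `q`; by convention it is the zero
sequence whenever no infinite expansion exists (in particular for `x = 0`). -/
def quasiGreedy (q x : ℝ) : ℕ → ℕ :=
  if h : ∃ a, IsQuasiGreedyOf q x a then h.choose else fun _ => 0

/-- The greedy expansion of `x` in base `q` (zero sequence if `x` has no expansion). -/
def greedy (q x : ℝ) : ℕ → ℕ :=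
  if h : ∃ b, IsGreedyOf q x b then h.choose else fun _ => 0

/-- The interval `J_q = [0, α₁/(q-1)]`. -/
def Jq (q : ℝ) : Set ℝ := Set.Icc 0 ((alphaOne q : ℝ) / (q - 1))

/-- `U_q`: the set of real numbers having exactly one expansion in base `q`. -/
def Uq (q : ℝ) : Set ℝ := {x | ∃! c, IsExpansionOf q x c}

/-- `U_q'`: the set of univoque sequences in base `q`. -/
def UqSeq (q : ℝ) : Set (ℕ → ℕ) := {c | ∃ x ∈ Uq q, IsExpansionOf q x c}

/-- `U`: the set of univoque numbers. -/
def USet : Set ℝ := {q | 1 < q ∧ ∃! c, IsExpansionOf q 1 c}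

/-- `V_q`: the set of `x ∈ J_q` such that for every `n ≥ 1` with `a_n(x) > 0` the
conjugated shifted quasi-greedy expansion is lexicographically at most `(α_i)`. -/
def Vq (q : ℝ) : Set ℝ :=
  {x | x ∈ Jq q ∧ ∀ n, 0 < quasiGreedy q x n →
    LexLe (fun i => alphaOne q - quasiGreedy q x (n + 1 + i)) (quasiGreedy q 1)}

/-- `V`: the set of `q > 1` whose quasi-greedy expansion `(α_i)` of `1` satisfies
`(α₁ - α_{k+i})_{i≥1} ≤ (α_i)_{i≥1}` lexicographically for all `k ≥ 1`. -/
def VSet : Set ℝ :=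
  {q | 1 < q ∧ ∀ k, LexLe (fun i => alphaOne q - quasiGreedy q 1 (k + 1 + i)) (quasiGreedy q 1)}

/-- The value `∑ c_i q^{-i}` of a sequence of digits in base `q`. -/
def digitSum (q : ℝ) (c : ℕ → ℕ) : ℝ := ∑' i, (c i : ℝ) / q ^ (i + 1)

section DigitSum

variable {q : ℝ} {A : ℕ} {c d : ℕ → ℕ}

lemma summable_const_digits (hq : 1 < q) (A : ℕ) :
    Summable fun i : ℕ => (A : ℝ) / q ^ (i + 1) := by
  have h := (summable_geometric_of_lt_one (by positivity) (inv_lt_one_of_one_lt₀ hq)).mul_left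
    ((A : ℝ) / q)
  refine h.congr fun i => ?_
  rw [pow_succ, inv_pow]
  field_simp

lemma summable_digits (hq : 1 < q) (hc : ∀ i, c i ≤ A) :
    Summable fun i => (c i : ℝ) / q ^ (i + 1) := by
  have hq0 : 0 < q := by linarith
  refine Summable.of_nonneg_of_le (fun i => by positivity) (fun i => ?_)
    (summable_const_digits hq A)
  have : (c i : ℝ) ≤ A := by exact_mod_cast hc i
  gcongr

lemma digitSum_const (hq : 1 < q) (A : ℕ) : digitSum q (fun _ => A) = A / (q - 1) := by
  have hq0 : 0 < q := by linarith
  have hq1 : q - 1 ≠ 0 := by linarith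
  have h : ∀ i : ℕ, (A : ℝ) / q ^ (i + 1) = (A : ℝ) / q * q⁻¹ ^ i := fun i => by
    rw [pow_succ, inv_pow]
    field_simp
  simp only [digitSum, h]
  rw [tsum_mul_left, tsum_geometric_of_lt_one (by positivity) (inv_lt_one_of_one_lt₀ hq)]
  have : 1 - q⁻¹ ≠ 0 := by
    have := inv_lt_one_of_one_lt₀ hq
    linarith
  field_simp

lemma digitSum_zero (q : ℝ) : digitSum q (fun _ => 0) = 0 := by simp [digitSum]

lemma digitSum_nonneg (hq : 1 < q) (c : ℕ → ℕ) : 0 ≤ digitSum q c := by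
  have hq0 : 0 < q := by linarith
  exact tsum_nonneg fun i => by positivity

lemma digitSum_pos (hq : 1 < q) (hc : ∀ i, c i ≤ A) {i : ℕ} (hi : c i ≠ 0) :
    0 < digitSum q c := by
  have hq0 : 0 < q := by linarith
  refine (summable_digits hq hc).tsum_pos (fun j => by positivity) i ?_
  have : 0 < (c i : ℝ) := by exact_mod_cast Nat.pos_of_ne_zero hi
  positivity

lemma digitSum_conj (hq : 1 < q) (hc : ∀ i, c i ≤ A) :
    digitSum q (fun i => A - c i) = A / (q - 1) - digitSum q c := by
  rw [← digitSum_const hq A]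
  unfold digitSum
  rw [← (summable_const_digits hq A).tsum_sub (summable_digits hq hc)]
  refine tsum_congr fun i => ?_
  rw [Nat.cast_sub (hc i), sub_div]

lemma digitSum_le (hq : 1 < q) (hc : ∀ i, c i ≤ A) : digitSum q c ≤ A / (q - 1) := by
  have := digitSum_conj hq hc
  have := digitSum_nonneg hq fun i => A - c i
  linarith

lemma eq_zero_of_digitSum_eq_zero (hq : 1 < q) (hc : ∀ i, c i ≤ A) (h : digitSum q c = 0)
    (i : ℕ) : c i = 0 := by
  by_contra hi
  exact (digitSum_pos hq hc hi).ne' h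

lemma eq_of_digitSum_eq_max (hq : 1 < q) (hc : ∀ i, c i ≤ A)
    (h : digitSum q c = A / (q - 1)) (i : ℕ) : c i = A := by
  have h0 := eq_zero_of_digitSum_eq_zero (A := A) hq (fun i => Nat.sub_le A (c i))
    (by rw [digitSum_conj hq hc, h, sub_self]) i
  have := hc i
  omega

lemma mul_digitSum_shift (hq : 1 < q) (hc : ∀ i, c i ≤ A) (n : ℕ) :
    q * digitSum q (fun i => c (n + i)) = c n + digitSum q (fun i => c (n + 1 + i)) := by
  have hq0 : 0 < q := by linarith
  have hs := summable_digits hq (fun i => hc (n + i))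
  unfold digitSum
  rw [hs.tsum_eq_zero_add, mul_add, ← tsum_mul_left]
  congr 1
  · simp; field_simp
  · refine tsum_congr fun i => ?_
    rw [show n + (i + 1) = n + 1 + i by ring, pow_succ q (i + 1)]
    field_simp

lemma digitSum_eq_iff_shift (hq : 1 < q) (hc : ∀ i, c i ≤ A) (hd : ∀ i, d i ≤ A) {n : ℕ}
    (h : ∀ i < n, c i = d i) :
    digitSum q c = digitSum q d ↔
      digitSum q (fun i => c (n + i)) = digitSum q (fun i => d (n + i)) := by
  have hq0 : q ≠ 0 := by linarith
  induction n with
  | zero => simp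
  | succ n ih =>
    have hlt : ∀ i < n, c i = d i := fun i hi => h i (by omega)
    refine (ih hlt).trans ?_
    rw [← mul_right_inj' hq0, mul_digitSum_shift hq hc,
      mul_digitSum_shift hq hd, h n (by omega), add_right_inj]

lemma digitSum_eq_iff_add_shift (hq : 1 < q) (hc : ∀ i, c i ≤ A) (hd : ∀ i, d i ≤ A) {n : ℕ}
    (h : ∀ i < n, c i = d i) :
    digitSum q c = digitSum q d ↔
      c n + digitSum q (fun i => c (n + 1 + i)) = d n + digitSum q (fun i => d (n + 1 + i)) := by
  have hq0 : q ≠ 0 := by linarith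
  rw [digitSum_eq_iff_shift hq hc hd h, ← mul_right_inj' hq0, mul_digitSum_shift hq hc,
    mul_digitSum_shift hq hd]

lemma digitSum_shift_eq_of_orbit (hq : 1 < q) (hd : ∀ i, d i ≤ A) {t : ℕ → ℝ}
    (ht0 : ∀ n, 0 ≤ t n) (htM : ∀ n, t n ≤ A / (q - 1))
    (ht : ∀ n, q * t n = d n + t (n + 1)) (n : ℕ) :
    digitSum q (fun i => d (n + i)) = t n := by
  set e : ℕ → ℝ := fun n => digitSum q (fun i => d (n + i)) - t n with he
  have hstep : ∀ n, e (n + 1) = q * e n := fun n => by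
    simp only [he]
    linarith [mul_digitSum_shift hq hd n, ht n]
  have hpow : ∀ m, e (n + m) = q ^ m * e n := fun m => by
    induction m with
    | zero => simp
    | succ m ih => rw [← add_assoc, hstep, ih]; ring
  have hbound : ∀ m, |e m| ≤ A / (q - 1) := fun m => by
    have h1 := digitSum_nonneg hq fun i => d (m + i)
    have h2 := digitSum_le hq fun i => hd (m + i)
    simp only [he]
    rw [abs_le]
    constructor <;> linarith [ht0 m, htM m]
  by_contra hne
  have hpos : 0 < |e n| := abs_pos.mpr (sub_ne_zero.mpr hne)
  obtain ⟨m, hm⟩ := pow_unbounded_of_one_lt ((A : ℝ) / (q - 1) / |e n|) hq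
  rw [div_lt_iff₀ hpos] at hm
  have := hbound (n + m)
  rw [hpow, abs_mul, abs_of_pos (by positivity)] at this
  linarith

lemma exists_infiniteSeq_digitSum_eq (hq : 1 < q) (hA : q - 1 ≤ A) {x : ℝ} (hx : 0 < x)
    (hxM : x ≤ A / (q - 1)) :
    ∃ d : ℕ → ℕ, (∀ i, d i ≤ A) ∧ InfiniteSeq d ∧ digitSum q d = x := by
  have hq0 : 0 < q := by linarith
  have hq1 : 0 < q - 1 := by linarith
  let δ : ℝ → ℕ := fun y => min A (⌈q * y⌉₊ - 1)
  let t : ℕ → ℝ := fun n => Nat.rec x (fun _ y => q * y - δ y) n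
  have hstep : ∀ n, t (n + 1) = q * t n - δ (t n) := fun n => rfl
  have hM1 : 1 ≤ A / (q - 1) := by rwa [le_div_iff₀ hq1, one_mul]
  have ht : ∀ n, 0 < t n ∧ t n ≤ A / (q - 1) := fun n => by
    induction n with
    | zero => exact ⟨hx, hxM⟩
    | succ n ih =>
      obtain ⟨h0, h1⟩ := ih
      have hy : 0 < q * t n := by positivity
      have hceil : 0 < ⌈q * t n⌉₊ := Nat.ceil_pos.mpr hy
      have hlt := Nat.ceil_lt_add_one hy.le
      have hle := Nat.le_ceil (q * t n)
      have hcast : ((⌈q * t n⌉₊ - 1 : ℕ) : ℝ) = ⌈q * t n⌉₊ - 1 := by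
        rw [Nat.cast_sub hceil, Nat.cast_one]
      rw [hstep]
      rcases le_total A (⌈q * t n⌉₊ - 1) with hc | hc
      · have hδ : δ (t n) = A := min_eq_left hc
        have hc' : (A : ℝ) ≤ ((⌈q * t n⌉₊ - 1 : ℕ) : ℝ) := by exact_mod_cast hc
        have hqM : q * (A / (q - 1)) = A + A / (q - 1) := by field_simp; ring
        have := mul_le_mul_of_nonneg_left h1 hq0.le
        rw [hδ]
        constructor <;> linarith
      · have hδ : δ (t n) = ⌈q * t n⌉₊ - 1 := min_eq_right hc
        rw [hδ, hcast]
        constructor <;> linarith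
  have hd : ∀ i, δ (t i) ≤ A := fun i => min_le_left _ _
  have hsum := digitSum_shift_eq_of_orbit (d := fun n => δ (t n)) hq hd
    (fun n => (ht n).1.le) (fun n => (ht n).2) (fun n => by rw [hstep]; ring)
  refine ⟨fun n => δ (t n), hd, ?_, ?_⟩
  swap
  · have h0 := hsum 0
    simp only [zero_add] at h0
    exact h0
  intro hfin
  obtain ⟨n, hn⟩ := hfin.bddAbove
  have hzero : ∀ i, δ (t (n + 1 + i)) = 0 := fun i => by
    by_contra hi
    have : n + 1 + i ≤ n := hn hi
    omega
  have h1 := hsum (n + 1)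
  simp only [hzero, digitSum_zero] at h1
  exact (ht (n + 1)).1.ne h1

end DigitSum

lemma isExpansionOf_iff {q x : ℝ} {c : ℕ → ℕ} :
    IsExpansionOf q x c ↔ (∀ i, c i ≤ alphaOne q) ∧ x = digitSum q c := Iff.rfl

lemma sub_one_le_alphaOne (q : ℝ) : q - 1 ≤ alphaOne q := by
  have h1 : q ≤ ⌈q⌉ := Int.le_ceil q
  have h2 : ⌈q⌉ - 1 ≤ ((⌈q⌉ - 1).toNat : ℤ) := Int.self_le_toNat _
  have h3 : ((⌈q⌉ : ℝ) - 1) ≤ ((⌈q⌉ - 1).toNat : ℝ) := by exact_mod_cast h2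
  unfold alphaOne
  linarith

lemma alphaOne_le_of_sub_one_le {q : ℝ} {m : ℕ} (h : q - 1 ≤ m) : alphaOne q ≤ m := by
  unfold alphaOne
  rw [Int.toNat_le, sub_le_iff_le_add, Int.ceil_le]
  push_cast
  linarith

lemma alphaOne_pos {q : ℝ} (hq : 1 < q) : 0 < alphaOne q := by
  have h : (0 : ℝ) < alphaOne q := by linarith [sub_one_le_alphaOne q]
  exact_mod_cast h

lemma isQuasiGreedyOf_quasiGreedy {q x : ℝ} {i : ℕ} (h : quasiGreedy q x i ≠ 0) :
    IsQuasiGreedyOf q x (quasiGreedy q x) := by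
  unfold quasiGreedy at h ⊢
  split_ifs at h ⊢ with hex
  · exact hex.choose_spec
  · exact absurd rfl h

lemma InfiniteSeq.exists_shift_ne_zero {c : ℕ → ℕ} (hc : InfiniteSeq c) (n : ℕ) :
    ∃ i, c (n + i) ≠ 0 := by
  obtain ⟨m, hm, hnm⟩ := hc.exists_gt n
  exact ⟨m - n, by rwa [Nat.add_sub_cancel' hnm.le]⟩

lemma InfiniteSeq.of_shift {c : ℕ → ℕ} {n : ℕ} (hc : InfiniteSeq fun i => c (n + i)) :
    InfiniteSeq c :=
  (hc.image (add_right_injective n).injOn).mono (by rintro _ ⟨i, hi, rfl⟩; exact hi)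

lemma InfiniteSeq.shift {c : ℕ → ℕ} (hc : InfiniteSeq c) (n : ℕ) :
    InfiniteSeq fun i => c (n + i) := by
  intro hfin
  obtain ⟨m, hm⟩ := hfin.bddAbove
  obtain ⟨i, hi⟩ := hc.exists_shift_ne_zero (n + (m + 1))
  have : m + 1 + i ≤ m := hm (show c (n + (m + 1 + i)) ≠ 0 by rwa [← add_assoc])
  omega

lemma LexLt.not_lexLe {a b : ℕ → ℕ} (h : LexLt a b) : ¬ LexLe b a := by
  obtain ⟨n, hn, hlt⟩ := h
  rintro (⟨m, hm, hlt'⟩ | rfl)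
  · rcases lt_trichotomy n m with h | rfl | h
    · exact hlt.ne' (hm n h)
    · exact hlt.asymm hlt'
    · exact hlt'.ne' (hn m h)
  · exact lt_irrefl _ hlt

section QuasiGreedy

variable {q : ℝ} {α : ℕ → ℕ}

lemma IsQuasiGreedyOf.digitSum_shift_le_one (hq : 1 < q) (hα : IsQuasiGreedyOf q 1 α) (n : ℕ) :
    digitSum q (fun i => α (n + i)) ≤ 1 := by
  obtain ⟨⟨hdig, hval⟩, -, hmax⟩ := hα
  change 1 = digitSum q α at hval
  induction n with
  | zero => simpa using hval.ge
  | succ n ih =>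
    by_contra! hlt
    have hstep := mul_digitSum_shift hq hdig n
    have hA := sub_one_le_alphaOne q
    have hlt' : (α n : ℝ) < alphaOne q := by nlinarith
    have hαn : α n + 1 ≤ alphaOne q := by exact_mod_cast hlt'
    obtain ⟨d, hd, hinf, hsum⟩ := exists_infiniteSeq_digitSum_eq hq hA
      (sub_pos.mpr hlt) (by linarith [digitSum_le hq fun i => hdig (n + 1 + i)])
    let c : ℕ → ℕ := fun i => if i < n then α i else if i = n then α n + 1 else d (i - (n + 1))
    have hcs : (fun i => c (n + 1 + i)) = d := by
      funext i
      simp only [c]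
      rw [if_neg (by omega), if_neg (by omega), Nat.add_sub_cancel_left]
    have hcn : c n = α n + 1 := by simp [c]
    have hci : ∀ i < n, c i = α i := fun i hi => by simp [c, hi]
    have hcA : ∀ i, c i ≤ alphaOne q := fun i => by
      simp only [c]
      split_ifs
      exacts [hdig i, hαn, hd _]
    refine LexLt.not_lexLe ⟨n, fun i hi => (hci i hi).symm, by omega⟩
      (hmax c ⟨hcA, hval.trans ?_⟩ (.of_shift (n := n + 1) (by rwa [hcs])))
    refine ((digitSum_eq_iff_add_shift hq hcA hdig hci).mpr ?_).symm
    rw [hcs, hsum, hcn]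
    push_cast
    ring

lemma IsQuasiGreedyOf.apply_zero (hq : 1 < q) (hα : IsQuasiGreedyOf q 1 α) :
    α 0 = alphaOne q := by
  have h1 := hα.digitSum_shift_le_one hq 1
  have hstep := mul_digitSum_shift hq hα.1.1 0
  have hval : 1 = digitSum q α := hα.1.2
  simp only [zero_add, ← hval] at hstep
  exact (hα.1.1 0).antisymm (alphaOne_le_of_sub_one_le (by linarith))

lemma IsQuasiGreedyOf.shift_eq_self (hq : 1 < q) (hα : IsQuasiGreedyOf q 1 α) {n : ℕ}
    (hn : digitSum q (fun i => α (n + i)) = 1) (i : ℕ) : α (n + i) = α i := by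
  obtain ⟨⟨hdig, hval⟩, hinf, hmax⟩ := hα
  change 1 = digitSum q α at hval
  rcases hmax _ ⟨fun i => hdig (n + i), hn.symm⟩ (hinf.shift n) with ⟨m, hm, hlt⟩ | heq
  · exfalso
    let c : ℕ → ℕ := fun i => if i < n then α i else α (i - n)
    have hcs : (fun i => c (n + i)) = α := by
      funext i
      simp [c]
    have hci : ∀ i < n, c i = α i := fun i hi => by simp [c, hi]
    have hcA : ∀ i, c i ≤ alphaOne q := fun i => by
      simp only [c]
      split_ifs
      exacts [hdig _, hdig _]
    refine LexLt.not_lexLe (a := α) (b := c) ⟨n + m, fun i hi => ?_, ?_⟩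
      (hmax c ⟨hcA, hval.trans ?_⟩ (.of_shift (n := n) (by rwa [hcs])))
    · by_cases hin : i < n
      · exact (hci i hin).symm
      · obtain ⟨j, rfl⟩ := Nat.exists_eq_add_of_le (not_lt.mp hin)
        exact ((congrFun hcs j).trans (hm j (by omega)).symm).symm
    · rw [show c (n + m) = α m from congrFun hcs m]
      exact hlt
    · refine ((digitSum_eq_iff_shift hq hcA hdig hci).mpr ?_).symm
      rw [hcs, hn, ← hval]
  · exact congrFun heq i

end QuasiGreedy

section Antiperiodic

variable {A k : ℕ} {α : ℕ → ℕ}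

lemma apply_add_two_mul_of_conj (hA : ∀ i, α i ≤ A) (hk : ∀ j, A - α (k + j) = α j) (j : ℕ) :
    α (2 * k + j) = α j := by
  have h1 := hk j
  have h2 := hk (k + j)
  have := hA j
  have := hA (k + j)
  have := hA (k + (k + j))
  rw [show 2 * k + j = k + (k + j) by ring]
  omega

lemma apply_add_mul_of_conj (hA : ∀ i, α i ≤ A) (hk : ∀ j, A - α (k + j) = α j) (N j : ℕ) :
    α (N * (2 * k) + j) = α j := by
  induction N with
  | zero => simp
  | succ N ih =>
    rw [show (N + 1) * (2 * k) + j = 2 * k + (N * (2 * k) + j) by ring,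
      apply_add_two_mul_of_conj hA hk, ih]

lemma two_mul_dvd_of_shift_eq_self (hA : ∀ i, α i ≤ A) (h0 : α 0 = A) (hA0 : 0 < A)
    (hk : IsLeast {m : ℕ | 0 < m ∧ ∀ j : ℕ, A - α (m + j) = α j} k) {n : ℕ}
    (hn : ∀ i, α (n + i) = α i) : 2 * k ∣ n := by
  obtain ⟨⟨hkpos, hconj⟩, hmin⟩ := hk
  have hr : ∀ i, α (n % (2 * k) + i) = α i := fun i => by
    rw [← hn i, ← apply_add_mul_of_conj hA hconj (n / (2 * k))]
    congr 1
    rw [← add_assoc, mul_comm (n / (2 * k)), Nat.div_add_mod]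
  have hlt : n % (2 * k) < 2 * k := Nat.mod_lt _ (by omega)
  apply Nat.dvd_of_mod_eq_zero
  generalize n % (2 * k) = r at hr hlt
  by_contra hr0
  rcases lt_trichotomy r k with h | rfl | h
  · have : k ≤ k - r := hmin ⟨by omega, fun j => by
      rw [← hr (k - r + j), show r + (k - r + j) = k + j by omega, hconj]⟩
    omega
  · have h1 := hr 0
    have h2 := hconj 0
    omega
  · have : k ≤ r - k := hmin ⟨by omega, fun j => by
      rw [← hconj (r - k + j), show k + (r - k + j) = r + j by omega, hr]
      have := hA j
      omega⟩
    omega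

end Antiperiodic

section Main

variable {q : ℝ} {α : ℕ → ℕ} {k : ℕ}

lemma IsQuasiGreedyOf.digitSum_shift_eq_one_iff (hq : 1 < q) (hα : IsQuasiGreedyOf q 1 α)
    (hk : IsLeast {m : ℕ | 0 < m ∧ ∀ j : ℕ, alphaOne q - α (m + j) = α j} k) (n : ℕ) :
    digitSum q (fun i => α (n + i)) = 1 ↔ 2 * k ∣ n := by
  refine ⟨fun h => two_mul_dvd_of_shift_eq_self hα.1.1 (hα.apply_zero hq) (alphaOne_pos hq) hk
    (hα.shift_eq_self hq h), ?_⟩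
  rintro ⟨N, rfl⟩
  simp only [mul_comm (2 * k) N, apply_add_mul_of_conj hα.1.1 hk.1.2]
  exact hα.1.2.symm

lemma digitSum_shift_add_conj (hq : 1 < q) (hA : ∀ i, α i ≤ alphaOne q)
    (hk : ∀ j, alphaOne q - α (k + j) = α j) (n : ℕ) :
    digitSum q (fun i => α (n + i)) =
      alphaOne q / (q - 1) - digitSum q (fun i => α (n + k + i)) := by
  rw [← digitSum_conj hq fun i => hA (n + k + i)]
  congr 1
  funext i
  rw [← hk (n + i)]
  congr 2
  ring

lemma IsQuasiGreedyOf.apply_lt_alphaOne (hq : 1 < q) (hα : IsQuasiGreedyOf q 1 α)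
    (hk : IsLeast {m : ℕ | 0 < m ∧ ∀ j : ℕ, alphaOne q - α (m + j) = α j} k) {n : ℕ}
    (hn : 2 * k ∣ n + 1) : α n < alphaOne q := by
  have h1 := (hα.digitSum_shift_eq_one_iff hq hk (n + 1)).mpr hn
  have h2 := hα.digitSum_shift_le_one hq n
  have hstep := mul_digitSum_shift hq hα.1.1 n
  have h3 := digitSum_shift_add_conj hq hα.1.1 hk.1.2 0
  simp only [zero_add] at h3
  rw [← show 1 = digitSum q α from hα.1.2] at h3
  obtain ⟨i, hi⟩ := hα.2.1.exists_shift_ne_zero k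
  have h4 := digitSum_pos hq (fun i => hα.1.1 (k + i)) hi
  have h5 : 1 < (alphaOne q : ℝ) / (q - 1) := by linarith
  rw [lt_div_iff₀ (by linarith)] at h5
  have : (α n : ℝ) < alphaOne q := by nlinarith
  exact_mod_cast this

/-- An expansion of `1` lying lexicographically above the quasi-greedy one is finite. -/
lemma IsQuasiGreedyOf.expansion_above (hq : 1 < q) (hα : IsQuasiGreedyOf q 1 α)
    (hk : IsLeast {m : ℕ | 0 < m ∧ ∀ j : ℕ, alphaOne q - α (m + j) = α j} k)
    {c : ℕ → ℕ} (hcA : ∀ i, c i ≤ alphaOne q) {n : ℕ} (hc : ∀ i < n, c i = α i)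
    (hlt : α n < c n) :
    IsExpansionOf q 1 c ↔ 2 * k ∣ n + 1 ∧ c n = α n + 1 ∧ ∀ i, c (n + 1 + i) = 0 := by
  have hval : 1 = digitSum q α := hα.1.2
  rw [isExpansionOf_iff, and_iff_right hcA, hval, eq_comm,
    digitSum_eq_iff_add_shift hq hcA hα.1.1 hc, ← hα.digitSum_shift_eq_one_iff hq hk]
  constructor
  · intro h
    have h1 := hα.digitSum_shift_le_one hq (n + 1)
    have h2 := digitSum_nonneg hq fun i => c (n + 1 + i)
    have h3 : (α n : ℝ) + 1 ≤ c n := by exact_mod_cast hlt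
    refine ⟨by linarith, ?_, eq_zero_of_digitSum_eq_zero hq (fun i => hcA _) (by linarith)⟩
    have h4 : (c n : ℝ) = α n + 1 := by linarith
    exact_mod_cast h4
  · rintro ⟨h1, h2, h3⟩
    simp only [h1, h2, h3, digitSum_zero]
    push_cast
    ring

/-- An expansion of `1` lying lexicographically below the quasi-greedy one ends in `α₁^∞`. -/
lemma IsQuasiGreedyOf.expansion_below (hq : 1 < q) (hα : IsQuasiGreedyOf q 1 α)
    (hk : IsLeast {m : ℕ | 0 < m ∧ ∀ j : ℕ, alphaOne q - α (m + j) = α j} k)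
    {c : ℕ → ℕ} (hcA : ∀ i, c i ≤ alphaOne q) {n : ℕ} (hc : ∀ i < n, c i = α i)
    (hlt : c n < α n) :
    IsExpansionOf q 1 c ↔
      2 * k ∣ n + 1 + k ∧ c n + 1 = α n ∧ ∀ i, c (n + 1 + i) = alphaOne q := by
  have hval : 1 = digitSum q α := hα.1.2
  rw [isExpansionOf_iff, and_iff_right hcA, hval, eq_comm,
    digitSum_eq_iff_add_shift hq hcA hα.1.1 hc, ← hα.digitSum_shift_eq_one_iff hq hk,
    digitSum_shift_add_conj hq hα.1.1 hk.1.2]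
  constructor
  · intro h
    have h1 := hα.digitSum_shift_le_one hq (n + 1 + k)
    have h2 := digitSum_le hq fun i => hcA (n + 1 + i)
    have h3 : (c n : ℝ) + 1 ≤ α n := by exact_mod_cast hlt
    refine ⟨by linarith, ?_, eq_of_digitSum_eq_max hq (fun i => hcA _) (by linarith)⟩
    have h4 : (c n : ℝ) + 1 = α n := by linarith
    exact_mod_cast h4
  · rintro ⟨h1, h2, h3⟩
    simp only [h1, ← h2, h3, digitSum_const hq]
    push_cast
    ring

end Main

/-- For `q ∈ V \ closure(U)` and `k` the least positive integer with
`α₁ - α_{k+i} = α_i` (all `i ≥ 1`), all expansions of `1` in base `q` are explicitly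
listed: `(α_i)` itself; `(α_1 … α_{2k})^N α_1 … α_{2k-1}(α_{2k}+1) 0^∞`; and
`(α_1 … α_{2k})^N α_1 … α_{k-1}(α_k-1) α₁^∞`. -/
theorem expansions_of_one_in_V_minus_closureU (q : ℝ) (hq : q ∈ VSet)
    (h : q ∉ closure USet) (k : ℕ)
    (hk : IsLeast {m : ℕ | 0 < m ∧
      ∀ j : ℕ, alphaOne q - quasiGreedy q 1 (m + j) = quasiGreedy q 1 j} k) :
    {c | IsExpansionOf q 1 c} =
      insert (quasiGreedy q 1)
        ((Set.range fun N : ℕ => fun i : ℕ =>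
            if i < N * (2 * k) + (2 * k - 1) then quasiGreedy q 1 i
            else if i = N * (2 * k) + (2 * k - 1) then quasiGreedy q 1 i + 1
            else 0) ∪
         (Set.range fun N : ℕ => fun i : ℕ =>
            if i < N * (2 * k) + (k - 1) then quasiGreedy q 1 i
            else if i = N * (2 * k) + (k - 1) then quasiGreedy q 1 i - 1
            else alphaOne q)) := by
  have hq1 : 1 < q := hq.1
  obtain ⟨hkpos, hconj⟩ := hk.1
  have hα : IsQuasiGreedyOf q 1 (quasiGreedy q 1) := by
    by_cases h0 : quasiGreedy q 1 0 = 0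
    · refine isQuasiGreedyOf_quasiGreedy (i := k) fun h1 => (alphaOne_pos hq1).ne' ?_
      simpa [h0, h1] using hconj 0
    · exact isQuasiGreedyOf_quasiGreedy h0
  generalize quasiGreedy q 1 = α at hk hconj hα
  have hA := hα.1.1
  ext c
  simp only [Set.mem_ofPred_eq, Set.mem_insert_iff, Set.mem_union, Set.mem_range]
  constructor
  · intro hc
    by_cases hne : c = α
    · exact Or.inl hne
    have hex : ∃ n, c n ≠ α n := Function.ne_iff.mp hne
    have hn := Nat.find_spec hex
    have hlt : ∀ i < Nat.find hex, c i = α i := fun i hi => not_not.mp (Nat.find_min hex hi)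
    generalize Nat.find hex = n at hn hlt
    have htail : ∀ {i}, n < i → ∃ j, i = n + 1 + j := fun hi => Nat.exists_eq_add_of_le hi
    rcases lt_or_gt_of_ne hn with hcn | hcn
    · obtain ⟨⟨N, hN⟩, h1, h2⟩ := (hα.expansion_below hq1 hk hc.1 hlt hcn).mp hc
      obtain ⟨M, rfl⟩ : ∃ M, N = M + 1 := Nat.exists_eq_add_one.mpr
        (Nat.pos_of_ne_zero (by rintro rfl; omega))
      refine Or.inr (Or.inr ⟨M, ?_⟩)
      have hn' : M * (2 * k) + (k - 1) = n := by
        have : 2 * k * (M + 1) = M * (2 * k) + 2 * k := by ring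
        omega
      rw [hn']
      funext i
      split_ifs with hi hi'
      · exact (hlt i hi).symm
      · subst hi'
        omega
      · obtain ⟨j, rfl⟩ := htail (show n < i by omega)
        exact (h2 j).symm
    · obtain ⟨⟨N, hN⟩, h1, h2⟩ := (hα.expansion_above hq1 hk hc.1 hlt hcn).mp hc
      obtain ⟨M, rfl⟩ : ∃ M, N = M + 1 := Nat.exists_eq_add_one.mpr
        (Nat.pos_of_ne_zero (by rintro rfl; omega))
      refine Or.inr (Or.inl ⟨M, ?_⟩)
      have hn' : M * (2 * k) + (2 * k - 1) = n := by
        have : 2 * k * (M + 1) = M * (2 * k) + 2 * k := by ring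
        omega
      rw [hn']
      funext i
      split_ifs with hi hi'
      · exact (hlt i hi).symm
      · subst hi'
        exact h1.symm
      · obtain ⟨j, rfl⟩ := htail (show n < i by omega)
        exact (h2 j).symm
  · rintro (rfl | ⟨N, rfl⟩ | ⟨N, rfl⟩)
    · exact hα.1
    · have hdvd : 2 * k ∣ N * (2 * k) + (2 * k - 1) + 1 :=
        ⟨N + 1, by rw [add_assoc, Nat.sub_add_cancel (by omega)]; ring⟩
      generalize N * (2 * k) + (2 * k - 1) = n at hdvd
      have hlt := hα.apply_lt_alphaOne hq1 hk hdvd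
      refine (hα.expansion_above (n := n) hq1 hk (fun i => ?_) (fun i hi => if_pos hi) ?_).mpr
        ⟨hdvd, by simp, fun i => ?_⟩
      · split_ifs with hi hi'
        exacts [hA i, hi' ▸ hlt, Nat.zero_le _]
      · simp
      · rw [if_neg (by omega), if_neg (by omega)]
    · have hdvd : 2 * k ∣ N * (2 * k) + (k - 1) + 1 + k :=
        ⟨N + 1, by rw [add_assoc _ _ 1, Nat.sub_add_cancel (by omega)]; ring⟩
      generalize N * (2 * k) + (k - 1) = n at hdvd
      have hlt := hα.apply_lt_alphaOne (n := k + n) hq1 hk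
        (by rwa [show k + n + 1 = n + 1 + k by ring])
      have hpos : 0 < α n := by
        have := hconj n
        omega
      refine (hα.expansion_below (n := n) hq1 hk (fun i => ?_) (fun i hi => if_pos hi) ?_).mpr
        ⟨hdvd, ?_, fun i => ?_⟩
      · split_ifs with hi hi'
        exacts [hA i, (Nat.sub_le _ _).trans (hA i), le_rfl]
      · simpa using hpos
      · simp only [lt_irrefl, if_false, if_true]
        omega
      · rw [if_neg (by omega), if_neg (by omega)]
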